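/- arXiv:1112.4657 — 2 statements merged into one kernel-verified Lean document; each statement's English description precedes it below -/
import Mathlib

section
/- (Miura identity.) Let u be a smooth function of (t,x) ∈ ℝ × ℝ. Define KdV(u) = u_t + u_{xxx} − 6 u u_x, mKdV(u) = u_t + u_{xxx} − 6 u² u_x, and miura(u) = u_x + u². Then KdV(miura(u)) = ∂_x(mKdV(u)) + 2u · mKdV(u). In particular, if u solves the mKdV equation then miura(u) solves the KdV equation. -/
/-!
STATEMENT 4: (Miura identity.) Let u be a smooth function of (t,x) ∈ ℝ × ℝ. Define
KdV(u) = u_t + u_{xxx} − 6 u u_x, mKdV(u) = u_t + u_{xxx} − 6 u² u_x, and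
miura(u) = u_x + u². Then KdV(miura(u)) = ∂_x(mKdV(u)) + 2u · mKdV(u).
In particular, if u solves the mKdV equation then miura(u) solves the KdV equation.
-/

open Real

noncomputable section

/-- `KdV(u) = u_t + u_{xxx} - 6 u u_x`. -/
def KdVop (u : ℝ → ℝ → ℝ) (t x : ℝ) : ℝ :=
  deriv (fun τ => u τ x) t + iteratedDeriv 3 (fun y => u t y) x
    - 6 * u t x * deriv (fun y => u t y) x

/-- `mKdV(u) = u_t + u_{xxx} - 6 u² u_x`. -/
def mKdVop (u : ℝ → ℝ → ℝ) (t x : ℝ) : ℝ :=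
  deriv (fun τ => u τ x) t + iteratedDeriv 3 (fun y => u t y) x
    - 6 * u t x ^ 2 * deriv (fun y => u t y) x

/-- The Miura map `miura(u) = u_x + u²`. -/
def miura (u : ℝ → ℝ → ℝ) (t x : ℝ) : ℝ := deriv (fun y => u t y) x + u t x ^ 2

lemma hasDerivAt_slice_right {u : ℝ → ℝ → ℝ} {t x : ℝ}
    (hu : DifferentiableAt ℝ (Function.uncurry u) (t, x)) :
    HasDerivAt (fun y => u t y) (fderiv ℝ (Function.uncurry u) (t, x) (0, 1)) x :=
  hu.hasFDerivAt.comp_hasDerivAt x ((hasDerivAt_const x t).prodMk (hasDerivAt_id x))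

lemma hasDerivAt_slice_left {u : ℝ → ℝ → ℝ} {t x : ℝ}
    (hu : DifferentiableAt ℝ (Function.uncurry u) (t, x)) :
    HasDerivAt (fun τ => u τ x) (fderiv ℝ (Function.uncurry u) (t, x) (1, 0)) t :=
  hu.hasFDerivAt.comp_hasDerivAt (f := fun τ => (τ, x)) t ((hasDerivAt_id t).prodMk (hasDerivAt_const t x))

lemma contDiff_deriv_right {u : ℝ → ℝ → ℝ}
    (hu : ContDiff ℝ (⊤ : ℕ∞) (Function.uncurry u)) :
    ContDiff ℝ (⊤ : ℕ∞) (Function.uncurry fun t x => deriv (fun y => u t y) x) := by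
  have h : (Function.uncurry fun t x => deriv (fun y => u t y) x) =
      fun p => fderiv ℝ (Function.uncurry u) p (0, 1) :=
    funext fun p => (hasDerivAt_slice_right (hu.differentiable (by simp) (p.1, p.2))).deriv
  rw [h]
  exact (hu.fderiv_right (m := (⊤ : ℕ∞)) (by simp)).clm_apply contDiff_const

lemma contDiff_deriv_left {u : ℝ → ℝ → ℝ}
    (hu : ContDiff ℝ (⊤ : ℕ∞) (Function.uncurry u)) :
    ContDiff ℝ (⊤ : ℕ∞) (Function.uncurry fun t x => deriv (fun τ => u τ x) t) := by
  have h : (Function.uncurry fun t x => deriv (fun τ => u τ x) t) =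
      fun p => fderiv ℝ (Function.uncurry u) p (1, 0) :=
    funext fun p => (hasDerivAt_slice_left (hu.differentiable (by simp) (p.1, p.2))).deriv
  rw [h]
  exact (hu.fderiv_right (m := (⊤ : ℕ∞)) (by simp)).clm_apply contDiff_const

lemma deriv_deriv_comm {u : ℝ → ℝ → ℝ}
    (hu : ContDiff ℝ (⊤ : ℕ∞) (Function.uncurry u)) (t x : ℝ) :
    deriv (fun τ => deriv (fun y => u τ y) x) t =
      deriv (fun y => deriv (fun τ => u τ y) t) x := by
  have hd : Differentiable ℝ (Function.uncurry u) := hu.differentiable (by simp)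
  have hf : DifferentiableAt ℝ (fderiv ℝ (Function.uncurry u)) (t, x) :=
    (hu.fderiv_right (m := (⊤ : ℕ∞)) (by simp)).differentiable (by simp) _
  have hl : HasDerivAt (fun τ => fderiv ℝ (Function.uncurry u) (τ, x))
      (fderiv ℝ (fderiv ℝ (Function.uncurry u)) (t, x) (1, 0)) t :=
    hf.hasFDerivAt.comp_hasDerivAt t ((hasDerivAt_id t).prodMk (hasDerivAt_const t x))
  have hr : HasDerivAt (fun y => fderiv ℝ (Function.uncurry u) (t, y))
      (fderiv ℝ (fderiv ℝ (Function.uncurry u)) (t, x) (0, 1)) x :=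
    hf.hasFDerivAt.comp_hasDerivAt x ((hasDerivAt_const x t).prodMk (hasDerivAt_id x))
  have hsymm : IsSymmSndFDerivAt ℝ (Function.uncurry u) (t, x) :=
    hu.contDiffAt.isSymmSndFDerivAt
      (by simpa using WithTop.coe_le_coe.2 (le_top (a := (2 : ℕ∞))))
  simp_rw [fun τ => (hasDerivAt_slice_right (hd (τ, x))).deriv,
    fun y => (hasDerivAt_slice_left (hd (t, y))).deriv]
  rw [(hl.clm_apply (hasDerivAt_const t ((0, 1) : ℝ × ℝ))).deriv,
    (hr.clm_apply (hasDerivAt_const x ((1, 0) : ℝ × ℝ))).deriv]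
  simpa using hsymm.eq (1, 0) (0, 1)

lemma KdVop_miura {u : ℝ → ℝ → ℝ}
    (hu : ContDiff ℝ (⊤ : ℕ∞) (Function.uncurry u)) (t x : ℝ) :
    KdVop (miura u) t x = deriv (fun y => mKdVop u t y) x + 2 * u t x * mKdVop u t x := by
  have hslice : ContDiff ℝ (⊤ : ℕ∞) (fun y => u t y) :=
    hu.comp (contDiff_const.prodMk contDiff_id)
  have hD (n : ℕ) (y : ℝ) : HasDerivAt (iteratedDeriv n (fun y => u t y))
      (iteratedDeriv (n + 1) (fun y => u t y) y) y := by
    rw [iteratedDeriv_succ]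
    exact (hslice.differentiable_iteratedDeriv n
      (WithTop.coe_lt_coe.2 (ENat.natCast_lt_top n)) y).hasDerivAt
  have hux : ∀ y, deriv (fun y => u t y) y = iteratedDeriv 1 (fun y => u t y) y := by
    simp [iteratedDeriv_one]
  have h0 (y : ℝ) : HasDerivAt (fun y => u t y) (iteratedDeriv 1 (fun y => u t y) y) y := by
    simpa using hD 0 y
  have hm1 (y : ℝ) : HasDerivAt (fun y => miura u t y)
      (iteratedDeriv 2 (fun y => u t y) y
        + 2 * u t y * iteratedDeriv 1 (fun y => u t y) y) y := by
    simp only [miura, hux]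
    exact ((hD 1 y).add ((h0 y).pow 2)).congr_deriv (by simp)
  have hm2 (y : ℝ) : HasDerivAt (deriv fun y => miura u t y)
      (iteratedDeriv 3 (fun y => u t y) y + 2 * iteratedDeriv 1 (fun y => u t y) y ^ 2
        + 2 * u t y * iteratedDeriv 2 (fun y => u t y) y) y := by
    rw [funext fun y => (hm1 y).deriv]
    exact ((hD 2 y).add (((h0 y).const_mul 2).mul (hD 1 y))).congr_deriv (by ring)
  have hm3 (y : ℝ) : HasDerivAt (deriv (deriv fun y => miura u t y))
      (iteratedDeriv 4 (fun y => u t y) y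
        + 6 * iteratedDeriv 1 (fun y => u t y) y * iteratedDeriv 2 (fun y => u t y) y
        + 2 * u t y * iteratedDeriv 3 (fun y => u t y) y) y := by
    rw [funext fun y => (hm2 y).deriv]
    exact (((hD 3 y).add (((hD 1 y).pow 2).const_mul 2)).add
      (((h0 y).const_mul 2).mul (hD 2 y))).congr_deriv (by simp; ring)
  have ht : HasDerivAt (fun τ => miura u τ x)
      (deriv (fun y => deriv (fun τ => u τ y) t) x
        + 2 * u t x * deriv (fun τ => u τ x) t) t := by
    have h1 := hasDerivAt_slice_left
      ((contDiff_deriv_right hu).differentiable (by simp) (t, x))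
    have h2 := hasDerivAt_slice_left (hu.differentiable (by simp) (t, x))
    rw [← deriv_deriv_comm hu]
    exact (h1.differentiableAt.hasDerivAt.add
      (h2.differentiableAt.hasDerivAt.pow 2)).congr_deriv (by simp)
  have hutx := (hasDerivAt_slice_right
    ((contDiff_deriv_left hu).differentiable (by simp) (t, x))).differentiableAt.hasDerivAt
  have hmK : HasDerivAt (fun y => mKdVop u t y)
      (deriv (fun y => deriv (fun τ => u τ y) t) x + iteratedDeriv 4 (fun y => u t y) x
        - (12 * u t x * iteratedDeriv 1 (fun y => u t y) x ^ 2
          + 6 * u t x ^ 2 * iteratedDeriv 2 (fun y => u t y) x)) x := by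
    simp only [mKdVop, hux]
    exact ((hutx.add (hD 3 x)).sub
      ((((h0 x).pow 2).const_mul 6).mul (hD 1 x))).congr_deriv (by simp; ring)
  have hm3' : iteratedDeriv 3 (fun y => miura u t y) x =
      deriv (deriv (deriv fun y => miura u t y)) x := by
    simp only [iteratedDeriv_succ, iteratedDeriv_zero]
  rw [hmK.deriv, KdVop, mKdVop, ht.deriv, hm3', (hm3 x).deriv, (hm1 x).deriv, miura, hux]
  ring

theorem miura_identity (u : ℝ → ℝ → ℝ) (hu : ContDiff ℝ (⊤ : ℕ∞) (Function.uncurry u)) :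
    (∀ t x : ℝ, KdVop (miura u) t x =
      deriv (fun y => mKdVop u t y) x + 2 * u t x * mKdVop u t x) ∧
    ((∀ t x : ℝ, mKdVop u t x = 0) → ∀ t x : ℝ, KdVop (miura u) t x = 0) := by
  refine ⟨KdVop_miura hu, fun h t x => ?_⟩
  rw [KdVop_miura hu]
  simp [h]

end
end

section
/- (Definition of the kink position by an orthogonality condition.) Fix R, δ > 0 and let η(x) = tanh((x−R)/2) + 1 + δ. There exist ε > 0 and a unique analytic function y defined on the set {f = tanh(·) + g : g ∈ L²(ℝ), ‖g‖_{L²} < ε} such that ⟨f(·) − tanh(· − y(f)), η(· − y(f)) sech²(· − y(f))⟩_{L²} = 0 for all such f, and y(tanh(·)) = 0. -/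
/-!
STATEMENT 10: (Definition of the kink position by an orthogonality condition.)
Fix R, δ > 0 and let η(x) = tanh((x−R)/2) + 1 + δ. There exist ε > 0 and a unique
analytic function y defined on the set {f = tanh(·) + g : g ∈ L²(ℝ), ‖g‖_{L²} < ε}
such that ⟨f(·) − tanh(· − y(f)), η(· − y(f)) sech²(· − y(f))⟩_{L²} = 0 for all
such f, and y(tanh(·)) = 0.

The domain is parametrised by the L² perturbation `g`, i.e. by the ball of radius
ε around 0 in `L²(ℝ)`, and analyticity of `y` is analyticity on that ball.
-/

open MeasureTheory Real Filter Topology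

noncomputable section

def sech (x : ℝ) : ℝ := 1 / Real.cosh x

/-- The weight `η_{R,δ}(x) = tanh((x−R)/2) + 1 + δ`. -/
def eta (R δ x : ℝ) : ℝ := Real.tanh ((x - R) / 2) + 1 + δ

open scoped BoundedContinuousFunction ContDiff

theorem analyticAt_real_tanh (x : ℝ) : AnalyticAt ℝ Real.tanh x := by
  have h : Real.tanh = fun x => Real.sinh x / Real.cosh x := by
    ext x; exact Real.tanh_eq_sinh_div_cosh x
  rw [h]
  exact Real.analyticAt_sinh.div Real.analyticAt_cosh (Real.cosh_pos x).ne'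

theorem continuous_real_tanh : Continuous Real.tanh :=
  continuous_iff_continuousAt.2 fun x => (analyticAt_real_tanh x).continuousAt

theorem continuous_sech : Continuous sech :=
  continuous_const.div Real.continuous_cosh fun x => (Real.cosh_pos x).ne'

theorem sech_pos (x : ℝ) : 0 < sech x := one_div_pos.2 (Real.cosh_pos x)

theorem hasDerivAt_real_tanh (x : ℝ) : HasDerivAt Real.tanh (sech x ^ 2) x := by
  have h : Real.tanh = fun x => Real.sinh x / Real.cosh x := by
    ext x; exact Real.tanh_eq_sinh_div_cosh x
  rw [h]
  convert! (Real.hasDerivAt_sinh x).div (Real.hasDerivAt_cosh x) (Real.cosh_pos x).ne' using 1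
  rw [sech, div_pow, one_pow]
  congr 1
  linarith [Real.cosh_sq x]

theorem sech_sq_eq (x : ℝ) : sech x ^ 2 = 1 - Real.tanh x ^ 2 := by
  have := (Real.cosh_pos x).ne'
  rw [sech, Real.tanh_eq_sinh_div_cosh]
  field_simp
  linarith [Real.cosh_sq x]

theorem abs_tanh_mul_tanh_lt_one (x y : ℝ) : |Real.tanh x * Real.tanh y| < 1 := by
  rw [abs_mul]
  exact mul_lt_one_of_nonneg_of_lt_one_left (abs_nonneg _) (Real.abs_tanh_lt_one x)
    (Real.abs_tanh_lt_one y).le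

theorem one_sub_tanh_mul_tanh_pos (x y : ℝ) : 0 < 1 - Real.tanh x * Real.tanh y := by
  linarith [(abs_lt.1 (abs_tanh_mul_tanh_lt_one x y)).2]

theorem real_tanh_sub (x y : ℝ) :
    Real.tanh (x - y) =
      (Real.tanh x - Real.tanh y) * (1 - Real.tanh y * Real.tanh x)⁻¹ := by
  have h := one_sub_tanh_mul_tanh_pos y x
  have hx := Real.cosh_pos x
  have hy := Real.cosh_pos y
  have hxy := Real.cosh_pos (x - y)
  have hc : Real.cosh x * Real.cosh y - Real.sinh x * Real.sinh y ≠ 0 := by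
    rw [← Real.cosh_sub]; exact hxy.ne'
  rw [← div_eq_mul_inv, eq_div_iff h.ne', Real.tanh_eq_sinh_div_cosh x,
    Real.tanh_eq_sinh_div_cosh y, Real.tanh_eq_sinh_div_cosh (x - y), Real.sinh_sub, Real.cosh_sub]
  rw [div_mul_eq_mul_div, div_eq_iff hc]
  field_simp

theorem sech_sub_sq (x y : ℝ) :
    sech (x - y) ^ 2 =
      sech x ^ 2 * ((1 - Real.tanh y ^ 2) * (1 - Real.tanh y * Real.tanh x)⁻¹ ^ 2) := by
  have h := mul_inv_cancel₀ (one_sub_tanh_mul_tanh_pos y x).ne'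
  rw [sech_sq_eq, sech_sq_eq, real_tanh_sub]
  linear_combination
    (-((1 - Real.tanh y * Real.tanh x) * (1 - Real.tanh y * Real.tanh x)⁻¹ + 1)) * h

theorem sech_sq_le (x : ℝ) : sech x ^ 2 ≤ (1 + x ^ 2)⁻¹ := by
  rw [sech, div_pow, one_pow, one_div]
  gcongr
  rw [Real.cosh_sq, add_comm]
  gcongr 1
  rw [sq_le_sq, Real.abs_sinh]
  exact Real.self_le_sinh_iff.2 (abs_nonneg x)

theorem integrable_sech_sq : Integrable fun x => sech x ^ 2 :=
  integrable_inv_one_add_sq.mono' (continuous_sech.pow 2).aestronglyMeasurable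
    (ae_of_all _ fun x => by
      rw [Real.norm_of_nonneg (sq_nonneg _)]; exact sech_sq_le x)

theorem sech_le_one (x : ℝ) : sech x ≤ 1 := by
  rw [sech, div_le_one (Real.cosh_pos x)]; exact Real.one_le_cosh x

theorem memLp_sech_sq : MemLp (fun x => sech x ^ 2) 2 := by
  refine (memLp_two_iff_integrable_sq (continuous_sech.pow 2).aestronglyMeasurable).2 ?_
  refine integrable_sech_sq.mono' ((continuous_sech.pow 2).pow 2).aestronglyMeasurable
    (ae_of_all _ fun x => ?_)
  rw [Real.norm_of_nonneg (by positivity)]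
  have h1 : sech x ^ 2 ≤ 1 := pow_le_one₀ (sech_pos x).le (sech_le_one x)
  change (sech x ^ 2) ^ 2 ≤ sech x ^ 2
  nlinarith [sq_nonneg (sech x)]

/-- `tanh ∘ u` translated by `y`, as a bounded continuous function. -/
def tanhTranslate (u : C(ℝ, ℝ)) (y : ℝ) : ℝ →ᵇ ℝ :=
  BoundedContinuousFunction.ofNormedAddCommGroup (fun x => Real.tanh (u x - y))
    (continuous_real_tanh.comp (u.continuous.sub continuous_const)) 1
    fun _ => (Real.abs_tanh_lt_one _).le

@[simp] theorem tanhTranslate_apply (u : C(ℝ, ℝ)) (y x : ℝ) :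
    tanhTranslate u y x = Real.tanh (u x - y) := rfl

/-- The inverse of `1 - tanh y • tanh ∘ u` among bounded continuous functions. -/
def tanhResolvent (u : C(ℝ, ℝ)) (y : ℝ) : ℝ →ᵇ ℝ :=
  Ring.inverse (1 - Real.tanh y • tanhTranslate u 0)

theorem norm_tanh_smul_tanhTranslate_lt_one (u : C(ℝ, ℝ)) (y : ℝ) :
    ‖Real.tanh y • tanhTranslate u 0‖ < 1 := by
  rw [norm_smul]
  have h : ‖tanhTranslate u 0‖ ≤ 1 :=
    BoundedContinuousFunction.norm_ofNormedAddCommGroup_le _ zero_le_one _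
  exact mul_lt_one_of_nonneg_of_lt_one_left (norm_nonneg _) (Real.abs_tanh_lt_one y) h

theorem isUnit_one_sub_tanh_smul (u : C(ℝ, ℝ)) (y : ℝ) :
    IsUnit (1 - Real.tanh y • tanhTranslate u 0) :=
  (Units.oneSub _ (norm_tanh_smul_tanhTranslate_lt_one u y)).isUnit

theorem tanhResolvent_apply (u : C(ℝ, ℝ)) (y x : ℝ) :
    tanhResolvent u y x = (1 - Real.tanh y * Real.tanh (u x))⁻¹ := by
  have h := congrArg (fun f : ℝ →ᵇ ℝ => f x)
    (Ring.inverse_mul_cancel _ (isUnit_one_sub_tanh_smul u y))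
  refine eq_inv_of_mul_eq_one_left ?_
  simpa [tanhResolvent] using h

theorem analyticAt_tanhResolvent (u : C(ℝ, ℝ)) (y : ℝ) : AnalyticAt ℝ (tanhResolvent u) y := by
  have h := isUnit_one_sub_tanh_smul u y
  have h1 : AnalyticAt ℝ (fun y => 1 - Real.tanh y • tanhTranslate u 0) y :=
    analyticAt_const.sub ((analyticAt_real_tanh y).smul analyticAt_const)
  have h2 : AnalyticAt ℝ Ring.inverse (1 - Real.tanh y • tanhTranslate u 0) :=
    analyticAt_inverse (𝕜 := ℝ) h.unit
  exact AnalyticAt.fun_comp (f := fun y => 1 - Real.tanh y • tanhTranslate u 0) h2 h1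

theorem analyticAt_tanhTranslate (u : C(ℝ, ℝ)) (y : ℝ) : AnalyticAt ℝ (tanhTranslate u) y := by
  have h : tanhTranslate u = fun y =>
      (tanhTranslate u 0 - Real.tanh y • 1) * tanhResolvent u y := by
    ext y x
    simp [tanhResolvent_apply, real_tanh_sub (u x) y]
  rw [h]
  exact (analyticAt_const.sub ((analyticAt_real_tanh y).smul analyticAt_const)).mul
    (analyticAt_tanhResolvent u y)

/-- The translated weight `η(· - y) sech²(· - y)` divided by `sech²`. -/
def relativeWeight (R δ y : ℝ) : ℝ →ᵇ ℝ :=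
  (tanhTranslate ⟨fun x => (x - R) / 2, by fun_prop⟩ (y / 2) +
      BoundedContinuousFunction.const ℝ (1 + δ)) *
    ((1 - Real.tanh y ^ 2) • tanhResolvent (ContinuousMap.id ℝ) y ^ 2)

theorem sech_sq_mul_relativeWeight (R δ y x : ℝ) :
    sech x ^ 2 * relativeWeight R δ y x = eta R δ (x - y) * sech (x - y) ^ 2 := by
  have h : (x - y - R) / 2 = (x - R) / 2 - y / 2 := by ring
  rw [sech_sub_sq, eta, h]
  simp [relativeWeight, tanhResolvent_apply]
  ring

theorem analyticAt_relativeWeight (R δ y : ℝ) : AnalyticAt ℝ (relativeWeight R δ) y := by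
  have h1 : AnalyticAt ℝ (fun y : ℝ => y / 2) y := analyticAt_id.div_const
  refine AnalyticAt.mul (((analyticAt_tanhTranslate _ _).fun_comp h1).add analyticAt_const)
    (AnalyticAt.smul (analyticAt_const.sub ((analyticAt_real_tanh y).pow 2))
      ((analyticAt_tanhResolvent _ y).pow 2))

/-- The kink displacement `tanh - tanh(· - y)` times the relative weight. -/
def weightedDisplacement (R δ y : ℝ) : ℝ →ᵇ ℝ :=
  (tanhTranslate (ContinuousMap.id ℝ) 0 - tanhTranslate (ContinuousMap.id ℝ) y) *
    relativeWeight R δ y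

theorem analyticAt_weightedDisplacement (R δ y : ℝ) :
    AnalyticAt ℝ (weightedDisplacement R δ) y :=
  (analyticAt_const.sub (analyticAt_tanhTranslate _ y)).mul (analyticAt_relativeWeight R δ y)

theorem norm_mul_boundedContinuous_le (f : ℝ → ℝ) (m : ℝ →ᵇ ℝ) (x : ℝ) :
    ‖f x * m x‖ ≤ ‖m‖ * ‖f x‖ := by
  rw [norm_mul, mul_comm]
  gcongr
  exact m.norm_coe_le_norm x

theorem integrable_sech_sq_mul (m : ℝ →ᵇ ℝ) : Integrable fun x => sech x ^ 2 * m x :=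
  (integrable_sech_sq.norm.const_mul ‖m‖).mono'
    ((continuous_sech.pow 2).mul m.continuous).aestronglyMeasurable
    (ae_of_all _ (norm_mul_boundedContinuous_le _ m))

theorem memLp_sech_sq_mul (m : ℝ →ᵇ ℝ) : MemLp (fun x => sech x ^ 2 * m x) 2 :=
  memLp_sech_sq.of_le_mul (c := ‖m‖)
    ((continuous_sech.pow 2).mul m.continuous).aestronglyMeasurable
    (ae_of_all _ (norm_mul_boundedContinuous_le _ m))

/-- Integration of bounded continuous functions against `sech²`. -/
def sechSqIntegral : (ℝ →ᵇ ℝ) →L[ℝ] ℝ :=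
  LinearMap.mkContinuous
    { toFun := fun m => ∫ x, sech x ^ 2 * m x
      map_add' := fun m n => by
        simp only [BoundedContinuousFunction.coe_add, Pi.add_apply, mul_add]
        exact integral_add (integrable_sech_sq_mul m) (integrable_sech_sq_mul n)
      map_smul' := fun c m => by
        simp only [BoundedContinuousFunction.coe_smul, smul_eq_mul, RingHom.id_apply,
          ← integral_const_mul]
        congr with x
        ring }
    (∫ x, ‖sech x ^ 2‖) fun m =>
      (norm_integral_le_of_norm_le (integrable_sech_sq.norm.const_mul ‖m‖)
        (ae_of_all _ (norm_mul_boundedContinuous_le _ m))).trans_eq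
          ((integral_const_mul _ _).trans (mul_comm _ _))

theorem sechSqIntegral_apply (m : ℝ →ᵇ ℝ) : sechSqIntegral m = ∫ x, sech x ^ 2 * m x := rfl

/-- Multiplication by `sech²` from bounded continuous functions to `L²`. -/
def sechSqMul : (ℝ →ᵇ ℝ) →L[ℝ] Lp ℝ 2 (volume : Measure ℝ) :=
  LinearMap.mkContinuous
    { toFun := fun m => (memLp_sech_sq_mul m).toLp _
      map_add' := fun m n => by
        rw [← MemLp.toLp_add]
        congr 1
        ext x
        simp [mul_add]
      map_smul' := fun c m => by
        rw [RingHom.id_apply, ← MemLp.toLp_const_smul]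
        congr 1
        ext x
        simp [mul_left_comm] }
    ‖memLp_sech_sq.toLp _‖ fun m => by
      rw [mul_comm]
      refine Lp.norm_le_mul_norm_of_ae_le_mul ?_
      filter_upwards [(memLp_sech_sq_mul m).coeFn_toLp, memLp_sech_sq.coeFn_toLp] with x h1 h2
      simp only [LinearMap.coe_mk, AddHom.coe_mk]
      rw [h1, h2]
      exact norm_mul_boundedContinuous_le (fun x => sech x ^ 2) m x

theorem sechSqMul_coeFn (m : ℝ →ᵇ ℝ) : sechSqMul m =ᵐ[volume] fun x => sech x ^ 2 * m x :=
  (memLp_sech_sq_mul m).coeFn_toLp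

/-- The orthogonality functional as a function of the perturbation and the position. -/
def kinkPairing (R δ : ℝ) (p : Lp ℝ 2 (volume : Measure ℝ) × ℝ) : ℝ :=
  sechSqIntegral (weightedDisplacement R δ p.2) + inner ℝ (sechSqMul (relativeWeight R δ p.2)) p.1

theorem integral_eq_kinkPairing (R δ : ℝ) (g : Lp ℝ 2 (volume : Measure ℝ)) (y : ℝ) :
    (∫ x : ℝ, (Real.tanh x + g x - Real.tanh (x - y)) *
      (eta R δ (x - y) * sech (x - y) ^ 2)) = kinkPairing R δ (g, y) := by
  rw [kinkPairing, sechSqIntegral_apply, L2.inner_def,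
    ← integral_add (integrable_sech_sq_mul _) (L2.integrable_inner _ _)]
  refine integral_congr_ae ?_
  filter_upwards [sechSqMul_coeFn (relativeWeight R δ y)] with x hx
  rw [hx, ← sech_sq_mul_relativeWeight]
  simp [weightedDisplacement]
  ring

theorem analyticAt_kinkPairing (R δ : ℝ) (p : Lp ℝ 2 (volume : Measure ℝ) × ℝ) :
    AnalyticAt ℝ (kinkPairing R δ) p := by
  have h1 : AnalyticAt ℝ (fun p : Lp ℝ 2 (volume : Measure ℝ) × ℝ =>
      sechSqIntegral (weightedDisplacement R δ p.2)) p :=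
    (sechSqIntegral.analyticAt _).fun_comp
      ((analyticAt_weightedDisplacement R δ p.2).fun_comp analyticAt_snd)
  have h2 : AnalyticAt ℝ (fun p : Lp ℝ 2 (volume : Measure ℝ) × ℝ =>
      sechSqMul (relativeWeight R δ p.2)) p :=
    (sechSqMul.analyticAt _).fun_comp ((analyticAt_relativeWeight R δ p.2).fun_comp analyticAt_snd)
  have h3 : AnalyticAt ℝ (fun p : Lp ℝ 2 (volume : Measure ℝ) × ℝ =>
      innerSL ℝ (sechSqMul (relativeWeight R δ p.2)) p.1) p :=
    ((innerSL ℝ).analyticAt_bilinear _).comp₂ h2 analyticAt_fst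
  exact h1.add h3

theorem kinkPairing_zero (R δ : ℝ) : kinkPairing R δ (0, 0) = 0 := by
  simp [kinkPairing, weightedDisplacement]

theorem deriv_tanhTranslate_apply (u : C(ℝ, ℝ)) (y x : ℝ) :
    deriv (tanhTranslate u) y x = -sech (u x - y) ^ 2 := by
  have h1 := (BoundedContinuousFunction.evalCLM ℝ x).hasFDerivAt.comp_hasDerivAt y
    (analyticAt_tanhTranslate u y).differentiableAt.hasDerivAt
  have h2 : HasDerivAt (fun y => Real.tanh (u x - y)) (sech (u x - y) ^ 2 * -1) y :=
    (hasDerivAt_real_tanh (u x - y)).comp y ((hasDerivAt_id y).const_sub (u x))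
  simpa using h1.unique h2

theorem eta_pos (R δ : ℝ) (hδ : 0 < δ) (x : ℝ) : 0 < eta R δ x := by
  have := Real.neg_one_lt_tanh ((x - R) / 2)
  rw [eta]; linarith

theorem exists_pos_hasDerivAt_kinkPairing (R δ : ℝ) (hδ : 0 < δ) :
    ∃ c : ℝ, 0 < c ∧ HasDerivAt (fun y => kinkPairing R δ (0, y)) c 0 := by
  have h0 := (analyticAt_tanhTranslate (ContinuousMap.id ℝ) 0).differentiableAt.hasDerivAt
  have h1 := (h0.const_sub (tanhTranslate (ContinuousMap.id ℝ) 0)).mul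
      (analyticAt_relativeWeight R δ 0).differentiableAt.hasDerivAt
  have h2 := sechSqIntegral.hasFDerivAt.comp_hasDerivAt 0 h1
  refine ⟨_, ?_, h2.congr_of_eventuallyEq (Eventually.of_forall fun y => ?_)⟩
  · have hpos : ∀ x, 0 < sech x ^ 2 * (eta R δ x * sech x ^ 2) := fun x =>
      mul_pos (pow_pos (sech_pos x) 2) (mul_pos (eta_pos R δ hδ x) (pow_pos (sech_pos x) 2))
    have heq : ∀ x, sech x ^ 2 * (eta R δ x * sech x ^ 2) =
        sech x ^ 2 * (-deriv (tanhTranslate (ContinuousMap.id ℝ)) 0 * relativeWeight R δ 0 +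
          (tanhTranslate (ContinuousMap.id ℝ) 0 - tanhTranslate (ContinuousMap.id ℝ) 0) *
            deriv (relativeWeight R δ) 0) x := fun x => by
      have h := sech_sq_mul_relativeWeight R δ 0 x
      rw [sub_zero] at h
      simp [deriv_tanhTranslate_apply, h]
    rw [sechSqIntegral_apply]
    refine integral_pos_of_integrable_nonneg_nonzero (x := 0)
      ((continuous_sech.pow 2).mul (BoundedContinuousFunction.continuous _))
      (integrable_sech_sq_mul _) (fun x => ?_) ?_
    · exact (hpos x).le.trans_eq (heq x)
    · exact ((hpos 0).trans_eq (heq 0)).ne'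
  · simp [kinkPairing, weightedDisplacement]

theorem exists_analytic_implicit_function {E : Type*} [NormedAddCommGroup E] [NormedSpace ℝ E]
    [CompleteSpace E] {F : E × ℝ → ℝ} (hF : AnalyticAt ℝ F (0, 0)) (h0 : F (0, 0) = 0) {c : ℝ}
    (hc : c ≠ 0) (hd : HasDerivAt (fun y => F (0, y)) c 0) :
    ∃ ε : ℝ, 0 < ε ∧ ∃ y : E → ℝ, AnalyticOnNhd ℝ y (Metric.ball 0 ε) ∧ y 0 = 0 ∧
      (∀ g ∈ Metric.ball (0 : E) ε, F (g, y g) = 0) ∧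
      ∀ y' : E → ℝ, AnalyticOnNhd ℝ y' (Metric.ball 0 ε) → y' 0 = 0 →
        (∀ g ∈ Metric.ball (0 : E) ε, F (g, y' g) = 0) →
        ∀ g ∈ Metric.ball (0 : E) ε, y' g = y g := by
  have cdf : ContDiffAt ℝ ω F (0, 0) := hF.contDiffAt
  have hpart : fderiv ℝ F (0, 0) ∘L .inr ℝ E ℝ = ContinuousLinearMap.toSpanSingleton ℝ c := by
    have h1 : HasFDerivAt (fun y : ℝ => F (0, y)) (fderiv ℝ F (0, 0) ∘L .inr ℝ E ℝ) 0 :=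
      HasFDerivAt.comp (0 : ℝ) (hF.differentiableAt.hasFDerivAt) (hasFDerivAt_prodMk_right 0 0)
    exact h1.unique hd.hasFDerivAt
  have hinv : (fderiv ℝ F (0, 0) ∘L .inr ℝ E ℝ).IsInvertible := by
    rw [hpart]
    refine ContinuousLinearMap.IsInvertible.of_inverse
      (g := ContinuousLinearMap.toSpanSingleton ℝ c⁻¹) ?_ ?_ <;> ext <;> simp [hc]
  have hω : (ω : ℕ∞ω) ≠ 0 := by simp
  have hy0 : cdf.implicitFunction hω hinv 0 = 0 := cdf.implicitFunction_apply_self hω hinv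
  have han : AnalyticAt ℝ (cdf.implicitFunction hω hinv) 0 :=
    (cdf.contDiffAt_implicitFunction hω hinv).analyticAt
  have hsol := cdf.eventually_apply_implicitFunction hω hinv
  have huniq := cdf.eventually_apply_eq_iff_implicitFunction hω hinv
  obtain ⟨ε, hε, hball⟩ := Metric.eventually_nhds_iff_ball.1 (han.eventually_analyticAt.and hsol)
  refine ⟨ε, hε, cdf.implicitFunction hω hinv, fun g hg => (hball g hg).1, hy0,
    fun g hg => (hball g hg).2.trans h0, fun y' hy' hy_zero hy_sol => ?_⟩
  have hmem : (0 : E) ∈ Metric.ball (0 : E) ε := Metric.mem_ball_self hε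
  refine hy'.eqOn_of_preconnected_of_eventuallyEq (fun g hg => (hball g hg).1)
    (convex_ball (0 : E) ε).isPreconnected hmem ?_
  have ht : Tendsto (fun g => (g, y' g)) (𝓝 (0 : E)) (𝓝 (0, 0)) := by
    have := (continuousAt_id (x := (0 : E))).prodMk (hy' 0 hmem).continuousAt
    simpa [ContinuousAt, hy_zero] using this
  filter_upwards [ht.eventually huniq, Metric.ball_mem_nhds (0 : E) hε] with g h1 h2
  exact (h1.1 ((hy_sol g h2).trans h0.symm)).symm

theorem kink_position_orthogonality (R δ : ℝ) (hR : 0 < R) (hδ : 0 < δ) :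
    ∃ ε : ℝ, 0 < ε ∧
      ∃ y : Lp ℝ 2 (volume : Measure ℝ) → ℝ,
        AnalyticOnNhd ℝ y (Metric.ball 0 ε) ∧
        y 0 = 0 ∧
        (∀ g ∈ Metric.ball (0 : Lp ℝ 2 (volume : Measure ℝ)) ε,
          (∫ x : ℝ, (Real.tanh x + g x - Real.tanh (x - y g)) *
            (eta R δ (x - y g) * sech (x - y g) ^ 2)) = 0) ∧
        -- uniqueness among analytic functions with these properties
        (∀ y' : Lp ℝ 2 (volume : Measure ℝ) → ℝ,
          AnalyticOnNhd ℝ y' (Metric.ball 0 ε) → y' 0 = 0 →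
          (∀ g ∈ Metric.ball (0 : Lp ℝ 2 (volume : Measure ℝ)) ε,
            (∫ x : ℝ, (Real.tanh x + g x - Real.tanh (x - y' g)) *
              (eta R δ (x - y' g) * sech (x - y' g) ^ 2)) = 0) →
          ∀ g ∈ Metric.ball (0 : Lp ℝ 2 (volume : Measure ℝ)) ε, y' g = y g) := by
  simp_rw [integral_eq_kinkPairing]
  obtain ⟨c, hc, hd⟩ := exists_pos_hasDerivAt_kinkPairing R δ hδ
  exact exists_analytic_implicit_function (analyticAt_kinkPairing R δ _) (kinkPairing_zero R δ)
    hc.ne' hd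

end
end
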